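/- The set S of possible ordered spectra of sums g Λ_A g⁻¹ + h Λ_B h⁻¹ over g, h ∈ SU(p,q) is a closed subset of ℝⁿ. -/

import Mathlib

open Matrix Polynomial

noncomputable section

/-- The signature matrix `J = diag(1,…,1,−1,…,−1)` with `p` ones and `q` minus ones. -/
def Jmat (p q : ℕ) : Matrix (Fin (p + q)) (Fin (p + q)) ℂ :=
  Matrix.diagonal fun i => if (i : ℕ) < p then 1 else -1

/-- The group `SU(p,q)` of complex `(p+q)×(p+q)` matrices `g` with `det g = 1` and
`gᴴ J g = J`. -/
def SUpq (p q : ℕ) : Set (Matrix (Fin (p + q)) (Fin (p + q)) ℂ) :=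
  { g | g.det = 1 ∧ g.conjTranspose * Jmat p q * g = Jmat p q }

/-- `x` is the ordered spectrum of `M`: the entries of `x` are non-increasing within the
first `p` coordinates and within the last `q` coordinates, every entry of the first block
is strictly greater than every entry of the second block, and the eigenvalues of `M`
counted with multiplicity are exactly the entries of `x` (its characteristic polynomial is
`∏ i (X - x i)`). -/
def IsOrderedSpectrum (p q : ℕ) (M : Matrix (Fin (p + q)) (Fin (p + q)) ℂ)
    (x : Fin (p + q) → ℝ) : Prop :=
  (∀ i j : Fin (p + q), i ≤ j → ((j : ℕ) < p ∨ p ≤ (i : ℕ)) → x j ≤ x i) ∧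
  (∀ i j : Fin (p + q), (i : ℕ) < p → p ≤ (j : ℕ) → x j < x i) ∧
  M.charpoly = ∏ i, (X - Polynomial.C ((x i : ℂ)))

/-- Sylvester's law of inertia for real diagonal forms, as an inequality of positive indices. -/
theorem card_pos_le_of_congruence {ι : Type*} [Fintype ι] [DecidableEq ι] (d e : ι → ℝ)
    (w : Matrix ι ι ℂ)
    (h : wᴴ * diagonal (fun i => (d i : ℂ)) * w = diagonal (fun i => (e i : ℂ))) :
    Fintype.card {i // 0 < e i} ≤ Fintype.card {i // 0 < d i} := by
  by_contra! hlt
  let f := (w.submatrix (Subtype.val : {i // 0 < d i} → ι)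
    (Subtype.val : {i // 0 < e i} → ι)).mulVecLin
  have hker : LinearMap.ker f ≠ ⊥ := LinearMap.ker_ne_bot_of_finrank_lt (by simpa using hlt)
  obtain ⟨v, hv, hv0⟩ := Submodule.exists_mem_ne_zero_of_ne_bot hker
  let v' : ι → ℂ := fun i => if h : 0 < e i then v ⟨i, h⟩ else 0
  have hform : ∀ (c : ι → ℝ) (u : ι → ℂ),
      star u ⬝ᵥ (diagonal (fun i => (c i : ℂ)) *ᵥ u) = ((∑ i, c i * ‖u i‖ ^ 2 : ℝ) : ℂ) := by
    intro c u
    simp only [dotProduct, mulVec_diagonal, Complex.ofReal_sum, Pi.star_apply]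
    refine Finset.sum_congr rfl fun i _ => ?_
    push_cast
    rw [← Complex.conj_mul']
    simp only [RCLike.star_def]
    ring
  have hwv : ∀ i, 0 < d i → (w *ᵥ v') i = 0 := by
    intro i hi
    have h1 : f v ⟨i, hi⟩ = 0 := by
      rw [LinearMap.mem_ker.mp hv]; rfl
    rw [← h1]
    simp only [f, mulVec, dotProduct, mulVecLin_apply, submatrix_apply]
    rw [← Fintype.sum_subtype_add_sum_subtype (fun j => 0 < e j) (fun j => w i j * v' j),
      Fintype.sum_eq_zero (fun j : {j // ¬ 0 < e j} => w i j * v' j)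
        (fun j => by simp only [v', dif_neg j.2, mul_zero]), add_zero]
    exact Fintype.sum_congr _ _ fun j => by simp only [v', dif_pos j.2]
  have key : ∑ i, e i * ‖v' i‖ ^ 2 = ∑ i, d i * ‖(w *ᵥ v') i‖ ^ 2 := by
    have h1 := hform e v'
    rw [← h, ← mulVec_mulVec, ← mulVec_mulVec, dotProduct_mulVec, vecMul_conjTranspose, star_star,
      hform d] at h1
    exact_mod_cast h1.symm
  have hle : ∑ i, d i * ‖(w *ᵥ v') i‖ ^ 2 ≤ 0 := by
    refine Finset.sum_nonpos fun i _ => ?_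
    by_cases hi : 0 < d i
    · simp [hwv i hi]
    · exact mul_nonpos_of_nonpos_of_nonneg (not_lt.mp hi) (by positivity)
  have hpos : 0 < ∑ i, e i * ‖v' i‖ ^ 2 := by
    obtain ⟨⟨i, hi⟩, hvi⟩ := Function.ne_iff.mp hv0
    refine Finset.sum_pos' (fun j _ => ?_) ⟨i, Finset.mem_univ _, ?_⟩
    · by_cases hj : 0 < e j
      · positivity
      · simp [v', hj]
    · have : v' i ≠ 0 := by simpa [v', hi] using hvi
      positivity
  linarith

/-- Unitary diagonalization of a Hermitian matrix, with the eigenvalues in a prescribed order. -/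
theorem Matrix.IsHermitian.exists_unitary_of_charpoly {ι : Type*} [Fintype ι] [DecidableEq ι]
    {H : Matrix ι ι ℂ} (hH : H.IsHermitian) (y : ι → ℝ)
    (hc : H.charpoly = ∏ i, (X - C ((y i : ℂ)))) :
    ∃ V : Matrix ι ι ℂ, Vᴴ * V = 1 ∧ H = V * diagonal (fun i => (y i : ℂ)) * Vᴴ := by
  have hD : (diagonal (fun i => (y i : ℂ))).IsHermitian :=
    isHermitian_diagonal_of_self_adjoint _ (by ext i; simp)
  have he : hH.eigenvalues = hD.eigenvalues := by
    rw [IsHermitian.eigenvalues_eq_eigenvalues_iff, hc, charpoly_diagonal]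
  have h1 := hH.spectral_theorem
  have h2 := hD.spectral_theorem
  rw [Unitary.conjStarAlgAut_apply] at h1 h2
  rw [he] at h1
  set U := hH.eigenvectorUnitary
  set W := hD.eigenvectorUnitary
  set E := diagonal (RCLike.ofReal (K := ℂ) ∘ hD.eigenvalues)
  have hU : star (U : Matrix ι ι ℂ) * U = 1 := Unitary.coe_star_mul_self U
  have hW : (W : Matrix ι ι ℂ) * star (W : Matrix ι ι ℂ) = 1 := Unitary.coe_mul_star_self W
  have hW' : star (W : Matrix ι ι ℂ) * W = 1 := Unitary.coe_star_mul_self W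
  refine ⟨U * star (W : Matrix ι ι ℂ), ?_, ?_⟩
  · rw [← star_eq_conjTranspose, star_mul, star_star]
    rw [mul_assoc, ← mul_assoc _ (U : Matrix ι ι ℂ), hU, one_mul, hW]
  · rw [← star_eq_conjTranspose, star_mul, star_star, h2, h1]
    calc _ = (U : Matrix ι ι ℂ) * (1 * E * 1) * star (U : Matrix ι ι ℂ) := by simp
      _ = _ := by rw [← hW']; simp only [mul_assoc]

open scoped ComplexOrder MatrixOrder Matrix.Norms.L2Operator in
theorem Matrix.PosDef.exists_eq_conjTranspose_mul_self {ι : Type*} [Fintype ι] [DecidableEq ι]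
    {M : Matrix ι ι ℂ} (hM : M.PosDef) : ∃ L : Matrix ι ι ℂ, IsUnit L ∧ M = Lᴴ * L := by
  obtain ⟨L, hL⟩ := CStarAlgebra.nonneg_iff_eq_star_mul_self.mp hM.posSemidef.nonneg
  rw [star_eq_conjTranspose] at hL
  refine ⟨L, ?_, hL⟩
  have h := hM.isUnit
  rw [hL, Matrix.isUnit_iff_isUnit_det, det_mul] at h
  exact (Matrix.isUnit_iff_isUnit_det L).mpr (isUnit_of_mul_isUnit_right h)

open scoped ComplexOrder in
/-- Simultaneous diagonalization of a definite form and an indefinite one. -/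
theorem Matrix.PosDef.exists_congruence {ι : Type*} [Fintype ι] [DecidableEq ι]
    {M S : Matrix ι ι ℂ} (hM : M.PosDef) (hS : S.IsHermitian) (hSS : S * S = 1) (y : ι → ℝ)
    (hc : (S * M).charpoly = ∏ i, (X - C ((y i : ℂ)))) :
    (∀ i, y i ≠ 0) ∧ ∃ w : Matrix ι ι ℂ,
      wᴴ * S * w = diagonal (fun i => ((y i / |y i| : ℝ) : ℂ)) ∧
      S * M * w = w * diagonal (fun i => (y i : ℂ)) := by
  obtain ⟨L, hL, rfl⟩ := hM.exists_eq_conjTranspose_mul_self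
  have hLL : L * L⁻¹ = 1 := mul_nonsing_inv _ ((isUnit_iff_isUnit_det L).mp hL)
  have hLL' : L⁻¹ * L = 1 := nonsing_inv_mul _ ((isUnit_iff_isUnit_det L).mp hL)
  set K := L⁻¹
  have hKL : Kᴴ * Lᴴ = 1 := by rw [← conjTranspose_mul, hLL, conjTranspose_one]
  have hH : (L * S * Lᴴ).IsHermitian := isHermitian_mul_mul_conjTranspose _ hS
  obtain ⟨V, hV, hVH⟩ := hH.exists_unitary_of_charpoly y
    (by rw [mul_assoc, charpoly_mul_comm, mul_assoc, hc])
  set D := diagonal (fun i => (y i : ℂ)) with hD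
  have hXD : Vᴴ * (Kᴴ * S * K) * V * D = 1 := by
    calc _ = Vᴴ * (Kᴴ * S * K) * (V * D * Vᴴ) * V := by
          simp only [mul_assoc, hV, mul_one]
      _ = Vᴴ * (Kᴴ * (S * ((K * L) * (S * Lᴴ)))) * V := by rw [← hVH]; simp only [mul_assoc]
      _ = 1 := by rw [hLL', one_mul, ← mul_assoc S, hSS, one_mul, hKL, mul_one, hV]
  have hy : ∀ i, y i ≠ 0 := by
    intro i hi
    have h1 := congrFun (congrFun hXD i) i
    rw [hD, mul_diagonal, hi] at h1
    simp at h1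
  refine ⟨hy, K * V * diagonal (fun i => ((√|y i| : ℝ) : ℂ)), ?_, ?_⟩
  · set R := diagonal (fun i => ((√|y i| : ℝ) : ℂ)) with hR
    have hRR : Rᴴ = R := by
      rw [hR, diagonal_conjTranspose]; congr 1; ext i; simp
    have hX : Vᴴ * (Kᴴ * S * K) * V = diagonal (fun i => ((y i : ℂ))⁻¹) := by
      calc _ = Vᴴ * (Kᴴ * S * K) * V * (D * diagonal (fun i => ((y i : ℂ))⁻¹)) := by
            rw [hD, diagonal_mul_diagonal]
            simp [hy]
        _ = _ := by rw [← mul_assoc, hXD, one_mul]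
    calc _ = R * (Vᴴ * (Kᴴ * S * K) * V) * R := by
          simp only [conjTranspose_mul, hRR, mul_assoc]
      _ = _ := by
        rw [hX, hR, diagonal_mul_diagonal, diagonal_mul_diagonal]
        congr 1; ext i
        norm_cast
        have h1 := Real.mul_self_sqrt (abs_nonneg (y i))
        have h2 : |y i| ≠ 0 := abs_ne_zero.mpr (hy i)
        rw [mul_right_comm, h1, ← div_eq_mul_inv, div_eq_div_iff (hy i) h2,
          abs_mul_abs_self]
  · set R := diagonal (fun i => ((√|y i| : ℝ) : ℂ)) with hR
    have hRD : R * D = D * R := by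
      rw [hR, hD, diagonal_mul_diagonal, diagonal_mul_diagonal]; simp only [mul_comm]
    calc _ = S * Lᴴ * (L * K) * V * R := by simp only [mul_assoc]
      _ = (K * L) * (S * Lᴴ) * V * R := by rw [hLL, hLL', mul_one, one_mul]
      _ = K * (V * D * Vᴴ) * V * R := by rw [← hVH]; simp only [mul_assoc]
      _ = K * V * D * (Vᴴ * V) * R := by simp only [mul_assoc]
      _ = _ := by rw [hV, mul_one, mul_assoc _ R, hRD, mul_assoc]

/-- If a real diagonal form `e` is congruent to `d` and positive wherever `d` is, then it is positive
nowhere else. -/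
theorem pos_of_congruence {ι : Type*} [Fintype ι] [DecidableEq ι] {d e : ι → ℝ}
    {w : Matrix ι ι ℂ}
    (h : wᴴ * diagonal (fun i => (d i : ℂ)) * w = diagonal (fun i => (e i : ℂ)))
    (hde : ∀ i, 0 < d i → 0 < e i) {i : ι} (hi : 0 < e i) : 0 < d i := by
  have h1 := card_pos_le_of_congruence d e w h
  rw [Fintype.card_subtype, Fintype.card_subtype] at h1
  have h2 := Finset.eq_of_subset_of_card_le
    (Finset.monotone_filter_right Finset.univ fun i _ => hde i) h1
  have h3 : i ∈ Finset.univ.filter fun i => 0 < e i := by simpa using hi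
  rw [← h2] at h3
  simpa using h3

/-- The diagonal entries of `Jmat p q`, as real numbers. -/
def Jsign (p q : ℕ) (i : Fin (p + q)) : ℝ := if (i : ℕ) < p then 1 else -1

theorem Jmat_eq (p q : ℕ) : Jmat p q = diagonal fun i => (Jsign p q i : ℂ) := by
  unfold Jmat Jsign
  congr 1; ext i; split_ifs <;> simp

theorem Jsign_of_lt {p q : ℕ} {i : Fin (p + q)} (h : (i : ℕ) < p) : Jsign p q i = 1 := if_pos h

theorem Jsign_of_le {p q : ℕ} {i : Fin (p + q)} (h : p ≤ (i : ℕ)) : Jsign p q i = -1 :=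
  if_neg h.not_gt

theorem Jsign_mul_self (p q : ℕ) (i : Fin (p + q)) : Jsign p q i * Jsign p q i = 1 := by
  unfold Jsign; split_ifs <;> simp

theorem Jsign_pos_iff {p q : ℕ} {i : Fin (p + q)} : 0 < Jsign p q i ↔ (i : ℕ) < p := by
  unfold Jsign; split_ifs with h <;> simp [h]

theorem Jmat_mul_self (p q : ℕ) : Jmat p q * Jmat p q = 1 := by
  rw [Jmat_eq, diagonal_mul_diagonal, ← diagonal_one]
  congr 1; ext i
  exact_mod_cast Jsign_mul_self p q i

theorem Jmat_isHermitian (p q : ℕ) : (Jmat p q).IsHermitian := by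
  rw [Jmat_eq]
  exact isHermitian_diagonal_of_self_adjoint _ (by ext i; simp)

theorem SUpq.inv_eq {p q : ℕ} {g : Matrix (Fin (p + q)) (Fin (p + q)) ℂ} (hg : g ∈ SUpq p q) :
    g⁻¹ = Jmat p q * gᴴ * Jmat p q := by
  refine inv_eq_left_inv ?_
  rw [mul_assoc, mul_assoc, ← mul_assoc gᴴ, hg.2, Jmat_mul_self]

theorem SUpq.inv_mul_cancel {p q : ℕ} {g : Matrix (Fin (p + q)) (Fin (p + q)) ℂ}
    (hg : g ∈ SUpq p q) : g⁻¹ * g = 1 :=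
  nonsing_inv_mul _ (by rw [hg.1]; exact isUnit_one)

theorem SUpq.mul_inv_cancel {p q : ℕ} {g : Matrix (Fin (p + q)) (Fin (p + q)) ℂ}
    (hg : g ∈ SUpq p q) : g * g⁻¹ = 1 :=
  mul_nonsing_inv _ (by rw [hg.1]; exact isUnit_one)

theorem SUpq.inv_mul_mem {p q : ℕ} {u g : Matrix (Fin (p + q)) (Fin (p + q)) ℂ}
    (hu : u ∈ SUpq p q) (hg : g ∈ SUpq p q) : u⁻¹ * g ∈ SUpq p q := by
  refine ⟨by rw [det_mul, det_nonsing_inv, hu.1, hg.1]; simp, ?_⟩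
  have h1 : (u⁻¹)ᴴ * uᴴ = 1 := by
    rw [← conjTranspose_mul, SUpq.mul_inv_cancel hu, conjTranspose_one]
  have h2 : (u⁻¹)ᴴ * Jmat p q * u⁻¹ = Jmat p q := by
    calc _ = (u⁻¹)ᴴ * (uᴴ * Jmat p q * u) * u⁻¹ := by rw [hu.2]
      _ = ((u⁻¹)ᴴ * uᴴ) * Jmat p q * (u * u⁻¹) := by simp only [mul_assoc]
      _ = _ := by rw [h1, SUpq.mul_inv_cancel hu, one_mul, mul_one]
  calc _ = gᴴ * ((u⁻¹)ᴴ * Jmat p q * u⁻¹) * g := by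
        simp only [conjTranspose_mul, mul_assoc]
    _ = _ := by rw [h2, hg.2]

theorem exists_smul_mem_SUpq {p q : ℕ} (hp : 1 ≤ p) {w : Matrix (Fin (p + q)) (Fin (p + q)) ℂ}
    (hw : wᴴ * Jmat p q * w = Jmat p q) : ∃ z : ℂ, z • w ∈ SUpq p q := by
  have hJ : (Jmat p q).det ≠ 0 := by
    intro h
    have := congrArg det (Jmat_mul_self p q)
    rw [det_mul, h] at this
    simp at this
  have hdet : ‖w.det‖ = 1 := by
    have h1 := congrArg det hw
    rw [det_mul, det_mul, mul_right_comm, mul_eq_right₀ hJ, det_conjTranspose] at h1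
    have h2 := congrArg norm h1
    rw [norm_mul, norm_star, norm_one] at h2
    nlinarith [norm_nonneg w.det]
  have hn : 0 < p + q := by omega
  obtain ⟨z, hz⟩ := IsAlgClosed.exists_pow_nat_eq (w.det)⁻¹ hn
  have hz1 : ‖z‖ = 1 := by
    have h1 := congrArg norm hz
    rw [norm_pow, norm_inv, hdet, inv_one] at h1
    exact (pow_eq_one_iff_of_nonneg (norm_nonneg z) hn.ne').mp h1
  refine ⟨z, ?_, ?_⟩
  · rw [det_smul, Fintype.card_fin, hz]
    refine inv_mul_cancel₀ fun h => ?_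
    simp [h] at hdet
  · have h1 : z * star z = 1 := by
      rw [RCLike.star_def, Complex.mul_conj', hz1]; simp
    rw [conjTranspose_smul, smul_mul_assoc, smul_mul_assoc, mul_smul_comm, smul_smul, hw,
      mul_comm, h1, one_smul]

open scoped ComplexOrder in
/-- A matrix `M` with ordered spectrum `x` and `J (M - γ)` positive definite is conjugate to
`diagonal x` under `SU(p,q)`, and `γ` separates the two blocks of its spectrum. -/
theorem IsOrderedSpectrum.exists_diagonalization {p q : ℕ} (hp : 1 ≤ p)
    {M : Matrix (Fin (p + q)) (Fin (p + q)) ℂ} {x : Fin (p + q) → ℝ} {γ : ℝ}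
    (hx : IsOrderedSpectrum p q M x)
    (hM : (Jmat p q * (M - scalar _ (γ : ℂ))).PosDef) :
    (∀ i, 0 < Jsign p q i * (x i - γ)) ∧
      ∃ u ∈ SUpq p q, M * u = u * diagonal (fun i => (x i : ℂ)) := by
  obtain ⟨-, hx2, hx3⟩ := hx
  have hJM : Jmat p q * (Jmat p q * (M - scalar _ (γ : ℂ))) = M - scalar _ (γ : ℂ) := by
    rw [← mul_assoc, Jmat_mul_self, one_mul]
  obtain ⟨hy, w, hw1, hw2⟩ := hM.exists_congruence (Jmat_isHermitian p q) (Jmat_mul_self p q)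
    (fun i => x i - γ) (by
      rw [hJM, charpoly_sub_scalar, hx3, prod_comp]
      refine Finset.prod_congr rfl fun i _ => ?_
      simp only [sub_comp, X_comp, C_comp, Complex.ofReal_sub, C_sub]
      ring)
  rw [hJM] at hw2
  have hw1' := hw1
  rw [Jmat_eq] at hw1
  have hw1n : wᴴ * diagonal (fun i => ((-Jsign p q i : ℝ) : ℂ)) * w =
      diagonal (fun i => ((-((x i - γ) / |x i - γ|) : ℝ) : ℂ)) := by
    have h1 := congrArg Neg.neg hw1
    rw [← neg_mul, ← mul_neg, diagonal_neg, diagonal_neg] at h1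
    simpa only [Complex.ofReal_neg] using h1
  have hpos : ∀ t : ℝ, 0 < t → 0 < t / |t| := fun t ht => div_pos ht (abs_pos.mpr ht.ne')
  have hneg : ∀ t : ℝ, t < 0 → 0 < -(t / |t|) := fun t ht => by
    rw [neg_pos]; exact div_neg_of_neg_of_pos ht (abs_pos.mpr ht.ne)
  have hsep : ∀ i, 0 < Jsign p q i * (x i - γ) := by
    intro i
    rcases lt_or_ge (i : ℕ) p with hi | hi
    · rw [Jsign_of_lt hi, one_mul]
      by_contra! hlt
      have hlt' := lt_of_le_of_ne hlt (hy i)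
      have := pos_of_congruence hw1n (fun j hj => hneg _ ?_) (hneg _ hlt')
      · rw [Jsign_of_lt hi] at this; linarith
      · have hj' : p ≤ (j : ℕ) := by
          by_contra! h
          rw [Jsign_of_lt h] at hj; linarith
        linarith [hx2 i j hi hj']
    · rw [Jsign_of_le hi]
      by_contra! hlt
      have hlt' : 0 < x i - γ := lt_of_le_of_ne (by linarith) (hy i).symm
      have := pos_of_congruence hw1 (fun j hj => hpos _ ?_) (hpos _ hlt')
      · exact absurd (Jsign_pos_iff.mp this) hi.not_gt
      · linarith [hx2 j i (Jsign_pos_iff.mp hj) hi]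
  have hw : wᴴ * Jmat p q * w = Jmat p q := by
    rw [hw1', Jmat_eq]
    congr 1; ext i
    have h1 := hsep i
    rcases lt_or_ge (i : ℕ) p with hi | hi
    · rw [Jsign_of_lt hi] at h1 ⊢
      rw [one_mul] at h1
      rw [abs_of_pos h1, div_self h1.ne']
    · rw [Jsign_of_le hi] at h1 ⊢
      have h2 : x i - γ < 0 := by linarith
      rw [abs_of_neg h2, div_neg, div_self h2.ne]
  obtain ⟨z, hz⟩ := exists_smul_mem_SUpq hp hw
  refine ⟨hsep, z • w, hz, ?_⟩
  have h1 : M * w = w * diagonal (fun i => (x i : ℂ)) := by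
    have h2 : diagonal (fun i => ((x i - γ : ℝ) : ℂ)) =
        diagonal (fun i => (x i : ℂ)) - scalar (Fin (p + q)) (γ : ℂ) := by
      rw [scalar_apply, diagonal_sub]; simp
    rw [h2, sub_mul, mul_sub, (scalar_commute (γ : ℂ) (fun r => mul_comm _ r) w).eq] at hw2
    exact sub_left_injective hw2
  rw [mul_smul_comm, h1, smul_mul_assoc]

theorem Jmat_mul_conj_sub_scalar {p q : ℕ} {g : Matrix (Fin (p + q)) (Fin (p + q)) ℂ}
    (hg : g ∈ SUpq p q) (a : Fin (p + q) → ℝ) (α : ℝ) :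
    Jmat p q * (g * diagonal (fun i => (a i : ℂ)) * g⁻¹ - scalar _ (α : ℂ)) =
      (Jmat p q * g) * diagonal (fun i => ((Jsign p q i * (a i - α) : ℝ) : ℂ)) *
        (Jmat p q * g)ᴴ := by
  have h1 : diagonal (fun i => ((Jsign p q i * (a i - α) : ℝ) : ℂ)) =
      (diagonal (fun i => (a i : ℂ)) - scalar _ (α : ℂ)) * Jmat p q := by
    rw [Jmat_eq, scalar_apply, diagonal_sub, diagonal_mul_diagonal]
    congr 1; ext i; push_cast; ring
  have h2 : scalar (Fin (p + q)) (α : ℂ) = g * scalar _ (α : ℂ) * g⁻¹ := by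
    rw [← (scalar_commute (α : ℂ) (fun r => mul_comm _ r) g).eq, mul_assoc,
      SUpq.mul_inv_cancel hg, mul_one]
  rw [h1, conjTranspose_mul, (Jmat_isHermitian p q).eq]
  conv_lhs => rw [h2, ← sub_mul, ← mul_sub, SUpq.inv_eq hg]
  simp only [mul_assoc]

open scoped ComplexOrder in
theorem posDef_Jmat_mul_conj_sub_scalar {p q : ℕ} {g : Matrix (Fin (p + q)) (Fin (p + q)) ℂ}
    (hg : g ∈ SUpq p q) {a : Fin (p + q) → ℝ} {α : ℝ} (ha : ∀ i, 0 < Jsign p q i * (a i - α)) :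
    (Jmat p q * (g * diagonal (fun i => (a i : ℂ)) * g⁻¹ - scalar _ (α : ℂ))).PosDef := by
  rw [Jmat_mul_conj_sub_scalar hg]
  refine PosDef.mul_mul_conjTranspose_same (PosDef.diagonal fun i => by exact_mod_cast ha i) ?_
  have h1 : (Jmat p q * g) * (g⁻¹ * Jmat p q) = 1 := by
    rw [mul_assoc, ← mul_assoc g, SUpq.mul_inv_cancel hg, one_mul, Jmat_mul_self]
  exact vecMul_injective_of_isUnit (IsUnit.of_mul_eq_one _ h1)

theorem Jmat_mul_conj_sub_scalar_apply {p q : ℕ} {g : Matrix (Fin (p + q)) (Fin (p + q)) ℂ}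
    (hg : g ∈ SUpq p q) (a : Fin (p + q) → ℝ) (α : ℝ) (i : Fin (p + q)) :
    (Jmat p q * (g * diagonal (fun i => (a i : ℂ)) * g⁻¹ - scalar (Fin (p + q)) (α : ℂ))) i i =
      ((∑ k, Jsign p q k * (a k - α) * ‖g i k‖ ^ 2 : ℝ) : ℂ) := by
  rw [Jmat_mul_conj_sub_scalar hg, mul_apply, Complex.ofReal_sum]
  refine Finset.sum_congr rfl fun k _ => ?_
  rw [mul_diagonal, conjTranspose_apply, Jmat_eq, diagonal_mul]
  have h1 : (Jsign p q i : ℂ) * Jsign p q i = 1 := by exact_mod_cast Jsign_mul_self p q i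
  have h2 := Complex.mul_conj' (g i k)
  simp only [RCLike.star_def, map_mul, Complex.conj_ofReal] at h2 ⊢
  push_cast
  rw [← h2]
  linear_combination ((Jsign p q k : ℂ) * (a k - α) * (g i k * (starRingEnd ℂ) (g i k))) * h1

/-- Two blocks of reals, one strictly above the other, are separated with a uniform margin. -/
theorem exists_uniform_separator {p q : ℕ} (hp : 1 ≤ p) (hq : 1 ≤ q) (a : Fin (p + q) → ℝ)
    (ha : ∀ i j : Fin (p + q), (i : ℕ) < p → p ≤ (j : ℕ) → a j < a i) :
    ∃ α ε : ℝ, 0 < ε ∧ ∀ k, ε ≤ Jsign p q k * (a k - α) := by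
  obtain ⟨i, hi, hi'⟩ := Finset.exists_min_image
    (Finset.univ.filter fun i : Fin (p + q) => (i : ℕ) < p) a ⟨⟨0, by omega⟩, by simp; omega⟩
  obtain ⟨j, hj, hj'⟩ := Finset.exists_max_image
    (Finset.univ.filter fun i : Fin (p + q) => p ≤ (i : ℕ)) a ⟨⟨p, by omega⟩, by simp⟩
  simp only [Finset.mem_filter, Finset.mem_univ, true_and] at hi hi' hj hj'
  refine ⟨(a i + a j) / 2, (a i - a j) / 2, by linarith [ha i j hi hj], fun k => ?_⟩
  rcases lt_or_ge (k : ℕ) p with hk | hk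
  · rw [Jsign_of_lt hk]; linarith [hi' k hk]
  · rw [Jsign_of_le hk]; linarith [hj' k hk]

/-- The box of matrices with entries bounded by `r` is compact. -/
theorem isCompact_setOf_norm_apply_le {m n : Type*} (r : ℝ) :
    IsCompact {g : Matrix m n ℂ | ∀ i j, ‖g i j‖ ≤ r} := by
  have h : IsCompact (Set.univ.pi fun _ : m => Set.univ.pi fun _ : n =>
      Metric.closedBall (0 : ℂ) r) :=
    isCompact_univ_pi fun _ => isCompact_univ_pi fun _ => isCompact_closedBall 0 r
  change IsCompact {g : m → n → ℂ | ∀ i j, ‖g i j‖ ≤ r}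
  convert h using 1
  ext g
  simp [Set.mem_pi]

theorem isClosed_SUpq (p q : ℕ) : IsClosed (SUpq p q) := by
  unfold SUpq
  refine (isClosed_eq ?_ continuous_const).inter (isClosed_eq ?_ continuous_const)
  · exact continuous_id.matrix_det
  · fun_prop

/-- The relation `g Λ_A g⁻¹ + h Λ_B h⁻¹ = diag x` bounds the entries of `g`. -/
theorem norm_sq_le_of_conj_add_conj_eq {p q : ℕ} {a b x : Fin (p + q) → ℝ} {α β ε : ℝ}
    (ha : ∀ k, ε ≤ Jsign p q k * (a k - α)) (hb : ∀ k, 0 ≤ Jsign p q k * (b k - β)) (hε : 0 < ε)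
    {g h : Matrix (Fin (p + q)) (Fin (p + q)) ℂ} (hg : g ∈ SUpq p q) (hh : h ∈ SUpq p q)
    (hgh : g * diagonal (fun i => (a i : ℂ)) * g⁻¹ + h * diagonal (fun i => (b i : ℂ)) * h⁻¹ =
      diagonal (fun i => (x i : ℂ))) (i k : Fin (p + q)) :
    ε * ‖g i k‖ ^ 2 ≤ |x i| + |α| + |β| := by
  have h1 := Jmat_mul_conj_sub_scalar_apply hg a α i
  have h2 := Jmat_mul_conj_sub_scalar_apply hh b β i
  have h3 : (∑ k, Jsign p q k * (a k - α) * ‖g i k‖ ^ 2) +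
      (∑ k, Jsign p q k * (b k - β) * ‖h i k‖ ^ 2) = Jsign p q i * (x i - α - β) := by
    have h4 : Jmat p q * (diagonal (fun i => (x i : ℂ)) - scalar _ (α : ℂ) - scalar _ (β : ℂ)) =
        Jmat p q * (g * diagonal (fun i => (a i : ℂ)) * g⁻¹ - scalar _ (α : ℂ)) +
        Jmat p q * (h * diagonal (fun i => (b i : ℂ)) * h⁻¹ - scalar _ (β : ℂ)) := by
      rw [← mul_add, ← hgh]; congr 1; abel
    have h5 := congrFun (congrFun h4 i) i
    rw [Matrix.add_apply, h1, h2, Jmat_eq, diagonal_mul] at h5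
    simp only [Matrix.sub_apply, diagonal_apply_eq, scalar_apply] at h5
    exact_mod_cast h5.symm
  have h4 : ε * ‖g i k‖ ^ 2 ≤ ∑ k, Jsign p q k * (a k - α) * ‖g i k‖ ^ 2 := by
    refine (mul_le_mul_of_nonneg_right (ha k) (by positivity)).trans ?_
    exact Finset.single_le_sum
      (f := fun k => Jsign p q k * (a k - α) * ‖g i k‖ ^ 2)
      (fun j _ => mul_nonneg (hε.le.trans (ha j)) (by positivity)) (Finset.mem_univ k)
  have h5 : 0 ≤ ∑ k, Jsign p q k * (b k - β) * ‖h i k‖ ^ 2 :=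
    Finset.sum_nonneg fun j _ => mul_nonneg (hb j) (by positivity)
  have h6 : Jsign p q i * (x i - α - β) ≤ |x i| + |α| + |β| := by
    have h7 := le_abs_self (x i); have h8 := neg_abs_le (x i)
    have h9 := le_abs_self α; have h10 := neg_abs_le α
    have h11 := le_abs_self β; have h12 := neg_abs_le β
    unfold Jsign; split_ifs <;> linarith
  linarith

open scoped ComplexOrder in
/-- Every point of the spectra set is attained by a sum which is itself diagonal, and its two blocks
are separated with the margin of the summands. -/
theorem IsOrderedSpectrum.exists_diagonal_sum {p q : ℕ} (hp : 1 ≤ p) {a b x : Fin (p + q) → ℝ}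
    {α β ε : ℝ} (hε : 0 < ε) (ha : ∀ k, ε ≤ Jsign p q k * (a k - α))
    (hb : ∀ k, ε ≤ Jsign p q k * (b k - β))
    {g h : Matrix (Fin (p + q)) (Fin (p + q)) ℂ} (hg : g ∈ SUpq p q) (hh : h ∈ SUpq p q)
    (hx : IsOrderedSpectrum p q (g * diagonal (fun i => (a i : ℂ)) * g⁻¹ +
      h * diagonal (fun i => (b i : ℂ)) * h⁻¹) x) :
    (∀ i, ε / 2 ≤ Jsign p q i * (x i - (α + β))) ∧ ∃ g ∈ SUpq p q, ∃ h ∈ SUpq p q,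
      g * diagonal (fun i => (a i : ℂ)) * g⁻¹ + h * diagonal (fun i => (b i : ℂ)) * h⁻¹ =
        diagonal (fun i => (x i : ℂ)) := by
  have key : ∀ t : ℝ, |t| < ε → _ := fun t ht => hx.exists_diagonalization hp (γ := α + t + β) (by
    have h1 := (posDef_Jmat_mul_conj_sub_scalar hg (a := a) (α := α + t) fun k => by
      have h2 := ha k
      have h3 := abs_lt.mp ht
      unfold Jsign at h2 ⊢
      split_ifs at h2 ⊢ <;> linarith).add
      (posDef_Jmat_mul_conj_sub_scalar hh (a := b) (α := β) fun k => hε.trans_le (hb k))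
    rw [← mul_add] at h1
    rw [Complex.ofReal_add (α + t) β, map_add, add_sub_add_comm]
    exact h1)
  refine ⟨fun i => ?_, ?_⟩
  · have h1 := (key (ε / 2) (by rw [abs_of_pos] <;> linarith)).1 i
    have h2 := (key (-(ε / 2)) (by rw [abs_neg, abs_of_pos] <;> linarith)).1 i
    unfold Jsign at h1 h2 ⊢
    split_ifs at h1 h2 ⊢ <;> linarith
  · obtain ⟨u, hu, huM⟩ := (key 0 (by simpa using hε)).2
    refine ⟨u⁻¹ * g, SUpq.inv_mul_mem hu hg, u⁻¹ * h, SUpq.inv_mul_mem hu hh, ?_⟩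
    have huu : (u⁻¹)⁻¹ = u := nonsing_inv_nonsing_inv _ (by rw [hu.1]; exact isUnit_one)
    rw [Matrix.mul_inv_rev, Matrix.mul_inv_rev, huu]
    calc _ = u⁻¹ * ((g * diagonal (fun i => (a i : ℂ)) * g⁻¹ +
          h * diagonal (fun i => (b i : ℂ)) * h⁻¹) * u) := by
          simp only [mul_add, add_mul, mul_assoc]
      _ = _ := by rw [huM, ← mul_assoc, SUpq.inv_mul_cancel hu, one_mul]

theorem isClosed_bounded_spectraSet {p q : ℕ} (hp : 1 ≤ p) {a b : Fin (p + q) → ℝ} {α β ε : ℝ}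
    (hε : 0 < ε) (ha : ∀ k, ε ≤ Jsign p q k * (a k - α)) (hb : ∀ k, ε ≤ Jsign p q k * (b k - β))
    (ρ : ℝ) :
    IsClosed ({ x : Fin (p + q) → ℝ |
      ∃ g ∈ SUpq p q, ∃ h ∈ SUpq p q,
        IsOrderedSpectrum p q
          (g * Matrix.diagonal (fun i => (a i : ℂ)) * g⁻¹ +
            h * Matrix.diagonal (fun i => (b i : ℂ)) * h⁻¹) x } ∩ Metric.closedBall 0 ρ) := by
  let r : ℝ := √((ρ + |α| + |β|) / ε)
  let B : Set (Matrix (Fin (p + q)) (Fin (p + q)) ℂ) := {g | ∀ i j, ‖g i j‖ ≤ r}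
  let K : Set ((Fin (p + q) → ℝ) × Matrix (Fin (p + q)) (Fin (p + q)) ℂ ×
      Matrix (Fin (p + q)) (Fin (p + q)) ℂ) :=
    Metric.closedBall 0 ρ ×ˢ (B ∩ SUpq p q) ×ˢ (B ∩ SUpq p q)
  have hK : IsCompact K :=
    (isCompact_closedBall 0 ρ).prod
      (((isCompact_setOf_norm_apply_le r).inter_right (isClosed_SUpq p q)).prod
        ((isCompact_setOf_norm_apply_le r).inter_right (isClosed_SUpq p q)))
  let F : Set ((Fin (p + q) → ℝ) × Matrix (Fin (p + q)) (Fin (p + q)) ℂ ×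
      Matrix (Fin (p + q)) (Fin (p + q)) ℂ) :=
    {z | (∀ i j : Fin (p + q), i ≤ j → ((j : ℕ) < p ∨ p ≤ (i : ℕ)) → z.1 j ≤ z.1 i) ∧
      (∀ i, ε / 2 ≤ Jsign p q i * (z.1 i - (α + β))) ∧
      z.2.1 * diagonal (fun i => (a i : ℂ)) * (Jmat p q * z.2.1ᴴ * Jmat p q) +
        z.2.2 * diagonal (fun i => (b i : ℂ)) * (Jmat p q * z.2.2ᴴ * Jmat p q) =
        diagonal (fun i => (z.1 i : ℂ))}
  have hF : IsClosed F := by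
    simp only [F, Set.ofPred_and]
    refine IsClosed.inter ?_ (IsClosed.inter ?_ ?_)
    · simp only [Set.ofPred_forall]
      exact isClosed_iInter fun i => isClosed_iInter fun j => isClosed_iInter fun _ =>
        isClosed_iInter fun _ => isClosed_le (by fun_prop) (by fun_prop)
    · simp only [Set.ofPred_forall]
      exact isClosed_iInter fun i => isClosed_le (by fun_prop) (by fun_prop)
    · refine isClosed_eq (by fun_prop) (Continuous.matrix_diagonal ?_)
      fun_prop
  convert ((hK.inter_right hF).image continuous_fst).isClosed using 1
  ext x
  constructor
  · rintro ⟨⟨g₀, hg₀, h₀, hh₀, hx⟩, hxρ⟩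
    obtain ⟨hsep, g, hg, h, hh, hgh⟩ := hx.exists_diagonal_sum hp hε ha hb hg₀ hh₀
    have hxi : ∀ i, |x i| ≤ ρ := fun i => by
      have h1 := norm_le_pi_norm x i
      rw [mem_closedBall_zero_iff] at hxρ
      exact h1.trans hxρ
    have hbound : ∀ t : ℝ, ∀ i, ε * t ^ 2 ≤ |x i| + |α| + |β| → t ≤ r := fun t i ht => by
      refine Real.le_sqrt_of_sq_le ?_
      rw [le_div_iff₀ hε]
      linarith [hxi i]
    refine ⟨(x, g, h), ⟨⟨hxρ, ⟨fun i k => hbound _ i ?_, hg⟩, fun i k => hbound _ i ?_, hh⟩,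
      hx.1, hsep, ?_⟩, rfl⟩
    · exact norm_sq_le_of_conj_add_conj_eq ha (fun k => hε.le.trans (hb k)) hε hg hh hgh i k
    · rw [add_comm (g * _ * _)] at hgh
      rw [add_right_comm]
      exact norm_sq_le_of_conj_add_conj_eq hb (fun k => hε.le.trans (ha k)) hε hh hg hgh i k
    · simpa only [SUpq.inv_eq hg, SUpq.inv_eq hh] using hgh
  · rintro ⟨⟨x, g, h⟩, ⟨⟨hxρ, ⟨-, hg⟩, -, hh⟩, hord, hsep, hgh⟩, rfl⟩
    refine ⟨⟨g, hg, h, hh, hord, fun i j hi hj => ?_, ?_⟩, hxρ⟩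
    · have h1 := hsep i
      have h2 := hsep j
      rw [Jsign_of_lt hi] at h1
      rw [Jsign_of_le hj] at h2
      dsimp only at h1 h2 ⊢
      linarith
    · rw [SUpq.inv_eq hg, SUpq.inv_eq hh]
      exact (congrArg charpoly hgh).trans (charpoly_diagonal _)

/-- the set `S` of ordered spectra of sums `g Λ_A g⁻¹ + h Λ_B h⁻¹`,
`g, h ∈ SU(p,q)`, is closed in `ℝⁿ`. -/
theorem spectraSet_isClosed (p q : ℕ) (hp : 1 ≤ p) (hq : 1 ≤ q)
    (a b : Fin (p + q) → ℝ)
    (ha0 : ∑ i, a i = 0) (hb0 : ∑ i, b i = 0)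
    (ha : ∀ i j : Fin (p + q), (i : ℕ) < p → p ≤ (j : ℕ) → a j < a i)
    (hb : ∀ i j : Fin (p + q), (i : ℕ) < p → p ≤ (j : ℕ) → b j < b i) :
    IsClosed { x : Fin (p + q) → ℝ |
      ∃ g ∈ SUpq p q, ∃ h ∈ SUpq p q,
        IsOrderedSpectrum p q
          (g * Matrix.diagonal (fun i => (a i : ℂ)) * g⁻¹ +
            h * Matrix.diagonal (fun i => (b i : ℂ)) * h⁻¹) x } := by
  obtain ⟨α, ε₁, hε₁, hα⟩ := exists_uniform_separator hp hq a ha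
  obtain ⟨β, ε₂, hε₂, hβ⟩ := exists_uniform_separator hp hq b hb
  refine IsSeqClosed.isClosed fun u x hu hux => ?_
  obtain ⟨ρ, hρ⟩ := (Metric.isBounded_range_of_tendsto u hux).subset_closedBall 0
  have h1 := isClosed_bounded_spectraSet hp (lt_min hε₁ hε₂)
    (fun k => (min_le_left _ _).trans (hα k)) (fun k => (min_le_right _ _).trans (hβ k)) ρ
  exact (h1.isSeqClosed (fun n => ⟨hu n, hρ (Set.mem_range_self n)⟩) hux).1
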